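/- Let d ≥ 1 and let H be a set of Lipschitz maps from ℝ^d to ℝ^d that is a sup-universal approximator for the set Lip(ℝ^d) of all Lipschitz maps from ℝ^d to ℝ^d. Then for every compactly supported C²-diffeomorphism G of ℝ^d, every compact set K ⊂ ℝ^d, and every ε > 0, there exist k ∈ ℕ and f_1, …, f_k ∈ H such that sup_{x∈K} ‖G(x) − (φ_{f_k}(·,1) ∘ ⋯ ∘ φ_{f_1}(·,1))(x)‖ < ε. -/

import Mathlib

open scoped ContDiff

noncomputable section

abbrev Euc (d : ℕ) := EuclideanSpace ℝ (Fin d)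

/-- `φ` is the global flow of the vector field `f`. -/
def IsFlow {E : Type*} [NormedAddCommGroup E] [NormedSpace ℝ E]
    (f : E → E) (φ : E → ℝ → E) : Prop :=
  ∀ x, φ x 0 = x ∧ ∀ t : ℝ, HasDerivAt (φ x) (f (φ x t)) t

/-- `iterComp k ψ = ψ (k-1) ∘ ⋯ ∘ ψ 0`. -/
def iterComp {E : Type*} : ∀ k : ℕ, (Fin k → E → E) → E → E
  | 0, _ => id
  | k + 1, ψ => iterComp k (fun i => ψ i.succ) ∘ ψ 0

/-- `g` is a compactly supported `C^r`-diffeomorphism of `ℝ^d`. -/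
def IsCompSuppDiffeo (d : ℕ) (r : ℕ∞) (g : Euc d → Euc d) : Prop :=
  ContDiff ℝ (r : WithTop ℕ∞) g ∧
  (∃ g' : Euc d → Euc d, ContDiff ℝ (r : WithTop ℕ∞) g' ∧
      Function.LeftInverse g' g ∧ Function.RightInverse g' g) ∧
  ∃ C : Set (Euc d), IsCompact C ∧ ∀ x ∉ C, g x = x

section LipschitzFlow

open Set Metric
open scoped NNReal Topology

variable {E : Type*} [NormedAddCommGroup E] [NormedSpace ℝ E]

lemma LipschitzWith.eqOn_Ioo_of_hasDerivAt {f : E → E} {C : ℝ≥0} (hf : LipschitzWith C f)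
    {γ₁ γ₂ : ℝ → E} {a b t₀ : ℝ} (ht₀ : t₀ ∈ Ioo a b)
    (h₁ : ∀ t ∈ Ioo a b, HasDerivAt γ₁ (f (γ₁ t)) t)
    (h₂ : ∀ t ∈ Ioo a b, HasDerivAt γ₂ (f (γ₂ t)) t) (h : γ₁ t₀ = γ₂ t₀) :
    EqOn γ₁ γ₂ (Ioo a b) :=
  ODE_solution_unique_of_mem_Ioo (v := fun _ => f) (s := fun _ => univ) (K := C)
    (fun _ _ => hf.lipschitzOnWith) ht₀ (fun t ht => ⟨h₁ t ht, trivial⟩)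
    (fun t ht => ⟨h₂ t ht, trivial⟩) h

/-- Solutions of a Lipschitz autonomous equation exist for a time independent of the initial
value. -/
lemma LipschitzWith.exists_hasDerivAt_Ioo [CompleteSpace E] {f : E → E} {C : ℝ≥0}
    (hf : LipschitzWith C f) (x : E) :
    ∃ γ : ℝ → E, γ 0 = x ∧
      ∀ t ∈ Ioo (-(1 + C : ℝ)⁻¹) (1 + C : ℝ)⁻¹, HasDerivAt γ (f (γ t)) t := by
  have hτ : (0 : ℝ) < (1 + C : ℝ)⁻¹ := by positivity
  have hPL : IsPicardLindelof (fun _ => f) (tmin := -(1 + C : ℝ)⁻¹) (tmax := (1 + C : ℝ)⁻¹)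
      ⟨0, by simpa using hτ.le, hτ.le⟩ x (‖f x‖₊ + 1) 0 ((1 + C) * (‖f x‖₊ + 1)) C := by
    refine IsPicardLindelof.of_time_independent (fun y hy => ?_) hf.lipschitzOnWith ?_
    · have h₁ := hf.norm_sub_le y x
      rw [mem_closedBall_iff_norm] at hy
      have h₂ : ‖f y‖ ≤ ‖f y - f x‖ + ‖f x‖ := norm_le_norm_sub_add _ _
      have h₃ := mul_le_mul_of_nonneg_left hy C.coe_nonneg
      push_cast at h₃ ⊢
      linarith
    · simp only [sub_zero, zero_sub, neg_neg, max_self]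
      push_cast
      rw [mul_right_comm, mul_inv_cancel₀ (by positivity)]
      simp
  obtain ⟨γ, hγ₀, hγ⟩ := hPL.exists_eq_forall_mem_Icc_hasDerivWithinAt₀
  exact ⟨γ, hγ₀, fun t ht =>
    (hγ t (Ioo_subset_Icc_self ht)).hasDerivAt (Icc_mem_nhds ht.1 ht.2)⟩

lemma LipschitzWith.exists_hasDerivAt_Ioo_extend {f : E → E} {C : ℝ≥0}
    (hf : LipschitzWith C f) {a : ℝ} (ha : 0 < a)
    (h : ∀ x, ∃ γ : ℝ → E, γ 0 = x ∧ ∀ t ∈ Ioo (-a) a, HasDerivAt γ (f (γ t)) t) (x : E) :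
    ∃ γ : ℝ → E, γ 0 = x ∧
      ∀ t ∈ Ioo (-(3 / 2 * a)) (3 / 2 * a), HasDerivAt γ (f (γ t)) t := by
  obtain ⟨γ, hγ₀, hγ⟩ := h x
  obtain ⟨β₁, hβ₁₀, hβ₁⟩ := h (γ (-(a / 2)))
  obtain ⟨β₂, hβ₂₀, hβ₂⟩ := h (γ (a / 2))
  set γ₁ : ℝ → E := fun t => β₁ (t + a / 2) with hγ₁_def
  set γ₂ : ℝ → E := fun t => β₂ (t - a / 2) with hγ₂_def
  have hγ₁ : ∀ t ∈ Ioo (-(3 / 2 * a)) (a / 2), HasDerivAt γ₁ (f (γ₁ t)) t := fun t ht =>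
    (hβ₁ (t + a / 2) ⟨by linarith [ht.1], by linarith [ht.2]⟩).comp_add_const t (a / 2)
  have hγ₂ : ∀ t ∈ Ioo (-(a / 2)) (3 / 2 * a), HasDerivAt γ₂ (f (γ₂ t)) t := fun t ht =>
    (hβ₂ (t - a / 2) ⟨by linarith [ht.1], by linarith [ht.2]⟩).comp_sub_const t (a / 2)
  have h₁ : γ₁ 0 = x := by
    rw [← hγ₀]
    refine hf.eqOn_Ioo_of_hasDerivAt (a := -a) (b := a / 2) (t₀ := -(a / 2))
      ⟨by linarith, by linarith⟩ (fun t ht => hγ₁ t ⟨by linarith [ht.1], ht.2⟩)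
      (fun t ht => hγ t ⟨ht.1, by linarith [ht.2]⟩) ?_ ⟨by linarith, by linarith⟩
    simp [hγ₁_def, hβ₁₀]
  have h₂ : γ₂ 0 = x := by
    rw [← hγ₀]
    refine hf.eqOn_Ioo_of_hasDerivAt (a := -(a / 2)) (b := a) (t₀ := a / 2)
      ⟨by linarith, by linarith⟩ (fun t ht => hγ₂ t ⟨ht.1, by linarith [ht.2]⟩)
      (fun t ht => hγ t ⟨by linarith [ht.1], ht.2⟩) ?_ ⟨by linarith, by linarith⟩
    simp [hγ₂_def, hβ₂₀]
  have h₁₂ : EqOn γ₁ γ₂ (Ioo (-(a / 2)) (a / 2)) :=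
    hf.eqOn_Ioo_of_hasDerivAt (t₀ := 0) ⟨by linarith, by linarith⟩
      (fun t ht => hγ₁ t ⟨by linarith [ht.1], ht.2⟩)
      (fun t ht => hγ₂ t ⟨ht.1, by linarith [ht.2]⟩) (h₁.trans h₂.symm)
  refine ⟨fun t => if t < 0 then γ₁ t else γ₂ t, by simpa using h₂, fun t ht => ?_⟩
  rcases lt_or_ge t 0 with h0 | h0
  · simp only [if_pos h0]
    refine (hγ₁ t ⟨ht.1, by linarith⟩).congr_of_eventuallyEq ?_
    filter_upwards [Iio_mem_nhds h0] with s hs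
    exact if_pos hs
  · simp only [if_neg h0.not_gt]
    refine (hγ₂ t ⟨by linarith, ht.2⟩).congr_of_eventuallyEq ?_
    filter_upwards [Ioo_mem_nhds (show -(a / 2) < t by linarith) ht.2] with s hs
    split_ifs with hs0
    · exact h₁₂ ⟨hs.1, by linarith⟩
    · rfl

/-- A Lipschitz vector field on a Banach space has a global flow. -/
lemma LipschitzWith.exists_isFlow [CompleteSpace E] {f : E → E} {C : ℝ≥0}
    (hf : LipschitzWith C f) : ∃ φ : E → ℝ → E, IsFlow f φ := by
  set τ : ℕ → ℝ := fun n => (3 / 2 : ℝ) ^ n * (1 + C : ℝ)⁻¹ with hτ_def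
  have hτ (n : ℕ) : 0 < τ n := by positivity
  have hloc (n : ℕ) : ∀ x, ∃ γ : ℝ → E, γ 0 = x ∧
      ∀ t ∈ Ioo (-τ n) (τ n), HasDerivAt γ (f (γ t)) t := by
    induction n with
    | zero => simpa [hτ_def] using hf.exists_hasDerivAt_Ioo
    | succ n ih =>
      have : τ (n + 1) = 3 / 2 * τ n := by simp only [hτ_def]; ring
      rw [this]
      exact hf.exists_hasDerivAt_Ioo_extend (hτ n) ih
  have hlarge (t : ℝ) : ∃ n, |t| < τ n := by
    obtain ⟨n, hn⟩ := pow_unbounded_of_one_lt (|t| * (1 + C)) (show (1 : ℝ) < 3 / 2 by norm_num)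
    refine ⟨n, ?_⟩
    simp only [hτ_def]
    rwa [← div_eq_mul_inv, lt_div_iff₀ (by positivity)]
  choose γ hγ₀ hγ using hloc
  choose N hN using hlarge
  have hcompat (x : E) (m n : ℕ) (t : ℝ) (hm : |t| < τ m) (hn : |t| < τ n) :
      γ m x t = γ n x t := by
    rw [abs_lt] at hm hn
    refine hf.eqOn_Ioo_of_hasDerivAt (a := -min (τ m) (τ n)) (b := min (τ m) (τ n)) (t₀ := 0)
      ⟨by simp [hτ], by simp [hτ]⟩ (fun s hs => hγ m x s ?_) (fun s hs => hγ n x s ?_)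
      ((hγ₀ m x).trans (hγ₀ n x).symm) ?_
    · exact Ioo_subset_Ioo (neg_le_neg (min_le_left _ _)) (min_le_left _ _) hs
    · exact Ioo_subset_Ioo (neg_le_neg (min_le_right _ _)) (min_le_right _ _) hs
    · exact abs_lt.1 (lt_min (abs_lt.2 hm) (abs_lt.2 hn))
  refine ⟨fun x t => γ (N t) x t, fun x => ⟨hγ₀ _ x, fun t => ?_⟩⟩
  refine (hγ (N t) x t (abs_lt.1 (hN t))).congr_of_eventuallyEq ?_
  filter_upwards [continuous_abs.continuousAt.eventually_lt continuousAt_const (hN t)] with s hs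
  exact hcompat x _ _ s (hN s) hs

lemma IsFlow.continuous {f : E → E} {φ : E → ℝ → E} (hφ : IsFlow f φ) (x : E) :
    Continuous (φ x) :=
  continuous_iff_continuousAt.2 fun t => ((hφ x).2 t).continuousAt

lemma IsFlow.dist_le {f : E → E} {C : ℝ≥0} (hf : LipschitzWith C f) {φ : E → ℝ → E}
    (hφ : IsFlow f φ) (x y : E) {t : ℝ} (ht : 0 ≤ t) :
    dist (φ x t) (φ y t) ≤ dist x y * Real.exp (C * t) := by
  have := dist_le_of_trajectories_ODE (v := fun _ => f) (K := C) (a := 0) (b := t)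
    (δ := dist x y) (fun _ => hf) (hφ.continuous x).continuousOn
    (fun s _ => ((hφ x).2 s).hasDerivWithinAt) (hφ.continuous y).continuousOn
    (fun s _ => ((hφ y).2 s).hasDerivWithinAt) (by rw [(hφ x).1, (hφ y).1]) t ⟨ht, le_rfl⟩
  simpa using this

/-- If `g` is uniformly `δ`-close to `f` on a large ball, trajectories of `g` starting in a given
bounded set stay close to those of `f` up to time `1`; the Lipschitz constant of `g` is
irrelevant. -/
lemma IsFlow.exists_forall_norm_sub_lt {f : E → E} {C : ℝ≥0} (hf : LipschitzWith C f)
    {φ : E → ℝ → E} (hφ : IsFlow f φ) {K : Set E} (hK : Bornology.IsBounded K) {ε : ℝ}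
    (hε : 0 < ε) :
    ∃ R δ : ℝ, 0 < δ ∧ ∀ (g : E → E) (ψ : E → ℝ → E), IsFlow g ψ →
      (∀ x ∈ closedBall (0 : E) R, ‖f x - g x‖ < δ) → ∀ x ∈ K, ‖φ x 1 - ψ x 1‖ < ε := by
  wlog hε1 : ε ≤ 1 generalizing ε
  · obtain ⟨R, δ, hδ, h⟩ := this one_pos le_rfl
    exact ⟨R, δ, hδ, fun g ψ hψ hg x hx => (h g ψ hψ hg x hx).trans (not_le.1 hε1)⟩
  obtain ⟨r, hr⟩ := hK.subset_closedBall 0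
  obtain ⟨ρ, hρ⟩ := (isCompact_Icc (a := (0 : ℝ)) (b := 1)).image (hφ.continuous 0)
    |>.isBounded.subset_closedBall (0 : E)
  have hbound : ∀ x ∈ K, ∀ t ∈ Icc (0 : ℝ) 1, ‖φ x t‖ ≤ r * Real.exp C + ρ := by
    intro x hx t ht
    have h₁ := hφ.dist_le hf x 0 ht.1
    have h₂ : ‖φ 0 t‖ ≤ ρ := by simpa using hρ (mem_image_of_mem _ ht)
    have h₃ : ‖x‖ ≤ r := by simpa using hr hx
    have h₄ : Real.exp (C * t) ≤ Real.exp C :=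
      Real.exp_le_exp.2 (mul_le_of_le_one_right C.coe_nonneg ht.2)
    rw [dist_eq_norm, dist_zero_right] at h₁
    have h₅ : ‖φ x t‖ ≤ ‖φ x t - φ 0 t‖ + ‖φ 0 t‖ := norm_le_norm_sub_add _ _
    have h₆ : ‖x‖ * Real.exp (C * t) ≤ r * Real.exp C :=
      mul_le_mul h₃ h₄ (Real.exp_pos _).le ((norm_nonneg _).trans h₃)
    linarith
  obtain ⟨δ, hδε, hδ⟩ : ∃ δ : ℝ, gronwallBound 0 C δ 1 < ε ∧ 0 < δ := by
    have hc := (gronwallBound_continuous_ε 0 C 1).continuousAt (x := 0)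
    have hev : ∀ᶠ δ in 𝓝[>] (0 : ℝ), gronwallBound 0 C δ 1 < ε :=
      (hc.eventually_lt continuousAt_const
        (by rw [gronwallBound_ε0_δ0]; exact hε)).filter_mono nhdsWithin_le_nhds
    exact (hev.and self_mem_nhdsWithin).exists
  refine ⟨r * Real.exp C + ρ + 1, δ, hδ, fun g ψ hψ hg x hx => ?_⟩
  have key : ∀ b ∈ Icc (0 : ℝ) 1, (∀ t ∈ Ico 0 b, ‖φ x t - ψ x t‖ < ε) →
      ‖φ x b - ψ x b‖ < ε := by
    intro b hb hclose
    have := dist_le_of_approx_trajectories_ODE (v := fun _ => f) (K := C) (a := 0) (b := b)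
      (δ := 0) (εf := 0) (εg := δ) (f := φ x) (g := ψ x) (fun _ => hf)
      (hφ.continuous x).continuousOn
      (fun s _ => ((hφ x).2 s).hasDerivWithinAt) (by simp) (hψ.continuous x).continuousOn
      (fun s _ => ((hψ x).2 s).hasDerivWithinAt) (fun t ht => ?_)
      (by rw [(hφ x).1, (hψ x).1, dist_self]) b ⟨hb.1, le_rfl⟩
    · rw [zero_add, sub_zero, dist_eq_norm] at this
      exact (this.trans (gronwallBound_mono le_rfl hδ.le C.coe_nonneg hb.2)).trans_lt hδε
    · rw [dist_comm, dist_eq_norm]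
      refine (hg _ ?_).le
      rw [mem_closedBall_zero_iff]
      have h₁ := hbound x hx t ⟨ht.1, ht.2.le.trans hb.2⟩
      have h₂ := norm_le_norm_add_norm_sub (φ x t) (ψ x t)
      linarith [hclose t ht]
  by_contra! hfar
  set S : Set ℝ := {t ∈ Icc (0 : ℝ) 1 | ε ≤ ‖φ x t - ψ x t‖}
  have hcont : Continuous fun t => ‖φ x t - ψ x t‖ :=
    ((hφ.continuous x).sub (hψ.continuous x)).norm
  have hS : IsCompact S := isCompact_Icc.inter_right (isClosed_le continuous_const hcont)
  obtain ⟨b, hbS, hbmin⟩ := hS.exists_isLeast ⟨1, ⟨zero_le_one, le_rfl⟩, hfar⟩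
  refine (key b hbS.1 fun t ht => ?_).not_ge hbS.2
  by_contra! hle
  exact (hbmin ⟨⟨ht.1, ht.2.le.trans hbS.1.2⟩, hle⟩).not_gt ht.2

end LipschitzFlow

section Pushforward

open Set Metric
open scoped NNReal

variable {E : Type*} [NormedAddCommGroup E] [NormedSpace ℝ E]

/-- The pushforward under a map `G` with inverse `G'` of the linear vector field
`x ↦ T • (x - p)`. -/
def pushRadial (G G' : E → E) (p : E) (T : ℝ) (y : E) : E :=
  fderiv ℝ G (G' y) (T • (G' y - p))

lemma isFlow_radial (p : E) (T : ℝ) :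
    IsFlow (fun x => T • (x - p)) (fun x t => p + Real.exp (t * T) • (x - p)) := by
  refine fun x => ⟨by simp, fun t => ?_⟩
  have h := (((hasDerivAt_id t).mul_const T).exp.smul_const (x - p)).const_add p
  refine h.congr_deriv ?_
  simp [smul_smul, mul_comm]

lemma isFlow_pushRadial {G G' : E → E} (hG : Differentiable ℝ G)
    (hl : Function.LeftInverse G' G) (hr : Function.RightInverse G' G) (p : E) (T : ℝ) :
    IsFlow (pushRadial G G' p T) (fun y t => G (p + Real.exp (t * T) • (G' y - p))) := by
  refine fun y => ⟨by simpa using hr y, fun t => ?_⟩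
  have h := (hG (p + Real.exp (t * T) • (G' y - p))).hasFDerivAt.comp_hasDerivAt t
    ((isFlow_radial p T (G' y)).2 t)
  simpa only [pushRadial, hl _, Function.comp_def] using h

lemma exists_lipschitzWith_pushRadial [ProperSpace E] {G G' : E → E} (hG : ContDiff ℝ 2 G)
    (hG' : ContDiff ℝ 2 G') (hl : Function.LeftInverse G' G) {S : Set E} (hS : IsCompact S)
    (hfix : ∀ x ∉ S, G x = x) (p : E) (T : ℝ) :
    ∃ C : ℝ≥0, LipschitzWith C (pushRadial G G' p T) := by
  have hG'1 : ContDiff ℝ 1 G' := hG'.of_le one_le_two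
  have hW : ContDiff ℝ 1 (pushRadial G G' p T) :=
    ((hG.fderiv_right (m := 1) (by norm_num)).comp hG'1).clm_apply
      (contDiff_const.smul (hG'1.sub contDiff_const))
  set L : E → E := fun y => T • (y - p)
  have hL : LipschitzWith ‖T‖₊ L :=
    LipschitzWith.of_dist_le_mul fun x y => by simp [L, dist_smul₀]
  have hdiff : ContDiff ℝ 1 fun y => pushRadial G G' p T y - L y :=
    hW.sub (contDiff_const.smul (contDiff_id.sub contDiff_const))
  have hsupp : HasCompactSupport fun y => pushRadial G G' p T y - L y := by
    refine HasCompactSupport.intro hS fun y hy => ?_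
    have hy' : G' y = y := by simpa [hfix y hy] using hl y
    have hd : fderiv ℝ G y = ContinuousLinearMap.id ℝ E := by
      rw [← fderiv_id (𝕜 := ℝ) (x := y)]
      refine Filter.EventuallyEq.fderiv_eq ?_
      filter_upwards [hS.isClosed.isOpen_compl.mem_nhds hy] with z hz using hfix z hz
    simp [pushRadial, hy', hd, L]
  obtain ⟨C, hC⟩ := hdiff.lipschitzWith_of_hasCompactSupport hsupp one_ne_zero
  exact ⟨C + ‖T‖₊, by simpa using hC.add hL⟩

end Pushforward

/-- if `H ⊆ Lip(ℝ^d)` is a sup-universal approximator for `Lip(ℝ^d)`, then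
every compactly supported `C²`-diffeomorphism of `ℝ^d` can be approximated uniformly on
compact sets by finite compositions of time-1 flow maps of elements of `H`. -/
theorem comp_supp_diffeo_approx_by_NODE_compositions
    (d : ℕ) (hd : 1 ≤ d) (H : Set (Euc d → Euc d))
    (hH : ∀ f ∈ H, ∃ C : NNReal, LipschitzWith C f)
    (huniv : ∀ F : Euc d → Euc d, (∃ C : NNReal, LipschitzWith C F) →
      ∀ K : Set (Euc d), IsCompact K → ∀ ε : ℝ, 0 < ε →
        ∃ g ∈ H, ∀ x ∈ K, ‖F x - g x‖ < ε)
    (G : Euc d → Euc d) (hG : IsCompSuppDiffeo d 2 G)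
    (K : Set (Euc d)) (hK : IsCompact K) (ε : ℝ) (hε : 0 < ε) :
    ∃ (k : ℕ), 1 ≤ k ∧ ∃ (f : Fin k → Euc d → Euc d) (φ : Fin k → Euc d → ℝ → Euc d),
      (∀ i, f i ∈ H) ∧ (∀ i, IsFlow (f i) (φ i)) ∧
      ∀ x ∈ K, ‖G x - iterComp k (fun i y => φ i y 1) x‖ < ε := by
  obtain ⟨hG2, ⟨G', hG'2, hl, hr⟩, S, hS, hfix⟩ := hG
  have : Nonempty (Fin d) := ⟨⟨0, hd⟩⟩
  obtain ⟨p, hp⟩ := (Set.ne_univ_iff_exists_notMem S).1 hS.ne_univ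
  obtain ⟨r, hr0, hball⟩ := Metric.isOpen_iff.1 hS.isClosed.isOpen_compl p hp
  obtain ⟨R, hR⟩ := hK.isBounded.subset_closedBall p
  obtain ⟨T, hT⟩ : ∃ T : ℝ, Real.exp (-T) * R < r := by
    have h := (Real.tendsto_exp_neg_atTop_nhds_zero.mul_const R)
    rw [zero_mul] at h
    exact (h.eventually (gt_mem_nhds hr0)).exists
  -- `G` agrees on `K` with the contraction towards `p` followed by the conjugated expansion.
  have hφ₁ := isFlow_radial p (-T)
  set φ₁ : Euc d → ℝ → Euc d := fun x t => p + Real.exp (t * (-T)) • (x - p) with hφ₁_def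
  have hφ₂ := isFlow_pushRadial (hG2.differentiable (by norm_num)) hl hr p T
  set φ₂ : Euc d → ℝ → Euc d := fun y t => G (p + Real.exp (t * T) • (G' y - p)) with hφ₂_def
  have hf₁ : LipschitzWith ‖-T‖₊ fun x : Euc d => (-T) • (x - p) :=
    LipschitzWith.of_dist_le_mul fun x y => by rw [dist_smul₀, dist_sub_right, coe_nnnorm]
  obtain ⟨C₂, hf₂⟩ := exists_lipschitzWith_pushRadial hG2 hG'2 hl hS hfix p T
  have hGK : ∀ x ∈ K, φ₂ (φ₁ x 1) 1 = G x := by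
    intro x hx
    have hmem : φ₁ x 1 ∉ S := by
      refine hball ?_
      have hxR : ‖x - p‖ ≤ R := by simpa [dist_eq_norm] using hR hx
      have : ‖Real.exp (-T) • (x - p)‖ < r := by
        rw [norm_smul, Real.norm_of_nonneg (Real.exp_pos _).le]
        exact (mul_le_mul_of_nonneg_left hxR (Real.exp_pos _).le).trans_lt hT
      simpa [hφ₁_def, dist_eq_norm] using this
    have hinv : G' (φ₁ x 1) = φ₁ x 1 := by simpa [hfix _ hmem] using hl (φ₁ x 1)
    calc φ₂ (φ₁ x 1) 1 = G (p + Real.exp (1 * T) • (φ₁ x 1 - p)) := by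
          simp only [hφ₂_def, hinv]
      _ = G x := by simp [hφ₁_def, smul_smul, ← Real.exp_add]
  have hφ₁c : Continuous fun x => φ₁ x 1 := by
    simp only [hφ₁_def]
    fun_prop
  have hK₁ : IsCompact (Metric.cthickening 1 ((fun x => φ₁ x 1) '' K)) :=
    (hK.image hφ₁c).cthickening
  obtain ⟨R₂, δ₂, hδ₂, h₂⟩ := hφ₂.exists_forall_norm_sub_lt hf₂ hK₁.isBounded (half_pos hε)
  obtain ⟨η, hη⟩ : ∃ η : ℝ, η = min 1 (ε / 2 / Real.exp C₂) := ⟨_, rfl⟩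
  have hη0 : 0 < η := by rw [hη]; positivity
  obtain ⟨R₁, δ₁, hδ₁, h₁⟩ := hφ₁.exists_forall_norm_sub_lt hf₁ hK.isBounded hη0
  obtain ⟨g₁, hg₁, hclose₁⟩ := huniv _ ⟨_, hf₁⟩ _ (isCompact_closedBall 0 R₁) δ₁ hδ₁
  obtain ⟨g₂, hg₂, hclose₂⟩ := huniv _ ⟨_, hf₂⟩ _ (isCompact_closedBall 0 R₂) δ₂ hδ₂
  obtain ⟨ψ₁, hψ₁⟩ := (hH g₁ hg₁).choose_spec.exists_isFlow
  obtain ⟨ψ₂, hψ₂⟩ := (hH g₂ hg₂).choose_spec.exists_isFlow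
  refine ⟨2, one_le_two, ![g₁, g₂], ![ψ₁, ψ₂], ?_, ?_, fun x hx => ?_⟩
  · simp [Fin.forall_fin_two, hg₁, hg₂]
  · simp [Fin.forall_fin_two, hψ₁, hψ₂]
  have hcomp : iterComp 2 (fun i y => (![ψ₁, ψ₂] : Fin 2 → Euc d → ℝ → Euc d) i y 1) x =
      ψ₂ (ψ₁ x 1) 1 := rfl
  rw [hcomp, ← hGK x hx]
  have hd₁ : ‖φ₁ x 1 - ψ₁ x 1‖ < η := h₁ g₁ ψ₁ hψ₁ hclose₁ x hx
  have hmem : ψ₁ x 1 ∈ Metric.cthickening 1 ((fun x => φ₁ x 1) '' K) := by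
    refine Metric.mem_cthickening_of_dist_le _ (φ₁ x 1) _ _ (Set.mem_image_of_mem _ hx) ?_
    rw [dist_comm, dist_eq_norm]
    exact hd₁.le.trans (hη ▸ min_le_left _ _)
  have hd₂ := h₂ g₂ ψ₂ hψ₂ hclose₂ _ hmem
  have hd₃ : ‖φ₂ (φ₁ x 1) 1 - φ₂ (ψ₁ x 1) 1‖ ≤ ε / 2 := by
    have h := hφ₂.dist_le hf₂ (φ₁ x 1) (ψ₁ x 1) zero_le_one
    rw [mul_one, dist_eq_norm, dist_eq_norm] at h
    refine h.trans ((le_div_iff₀ (Real.exp_pos _)).1 ?_)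
    exact hd₁.le.trans (hη ▸ min_le_right _ _)
  have := norm_sub_le_norm_sub_add_norm_sub (φ₂ (φ₁ x 1) 1) (φ₂ (ψ₁ x 1) 1) (ψ₂ (ψ₁ x 1) 1)
  linarith
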